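/- arXiv:1001.1890 — 2 statements merged into one kernel-verified Lean document; each statement's English description precedes it below -/
import Mathlib

section
/- Let {A(k)}_{k≥0} ⊂ 𝕊^m be a deterministic chain and z(k+1) = A(k)z(k) for k ≥ 0 with z(0) ∈ ℝ^m. Let σ be a permutation of {1,…,m} with z_{σ_1}(0) ≤ ⋯ ≤ z_{σ_m}(0) and assume z_{σ_1}(0) < z_{σ_m}(0). Let δ ∈ (0,1) and let T ≥ 1 satisfy Σ_{k=0}^{T−1} A_S(k) ≥ δ for every nonempty proper subset S ⊂ {1,…,m}. Then Σ_{k=0}^{T−1} Σ_{i<j} (A_{ij}(k) + A_{ji}(k)) (z_j(k) − z_i(k))^2 ≥ (δ(1−δ)^2 / (z_{σ_m}(0) − z_{σ_1}(0))) · Σ_{i=1}^{m−1} (z_{σ_{i+1}}(0) − z_{σ_i}(0))^3. -/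
open Filter MeasureTheory ProbabilityTheory Matrix

/-- An `m × m` real matrix is (row-)stochastic if all entries are nonnegative
and each row sums to `1`. -/
def IsStochastic {m : ℕ} (A : Matrix (Fin m) (Fin m) ℝ) : Prop :=
  (∀ i j, 0 ≤ A i j) ∧ ∀ i, ∑ j, A i j = 1

/-- The flow `W_S = Σ_{i∈S, j∉S} (W_{ij} + W_{ji})` across the cut `(S, Sᶜ)`. -/
noncomputable def flowAcross {m : ℕ} (A : Matrix (Fin m) (Fin m) ℝ) (S : Finset (Fin m)) : ℝ :=
  ∑ i ∈ S, ∑ j ∈ Sᶜ, (A i j + A j i)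

/-- `Phi A k t = A(k) A(k-1) ⋯ A(t)` (for `k ≥ t`). -/
noncomputable def Phi {m : ℕ} (A : ℕ → Matrix (Fin m) (Fin m) ℝ) (k t : ℕ) :
    Matrix (Fin m) (Fin m) ℝ :=
  ((List.range (k + 1 - t)).map (fun i => A (k - i))).prod

/-- A deterministic chain `{A(k)}` is ergodic if for every `t` and `j` there is a scalar
`g_j(t)` such that `Φ_{ij}(k,t) → g_j(t)` as `k → ∞`, for all `i`. -/
def IsErgodicChain {m : ℕ} (A : ℕ → Matrix (Fin m) (Fin m) ℝ) : Prop :=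
  ∀ t : ℕ, ∀ j : Fin m, ∃ g : ℝ, ∀ i : Fin m,
    Tendsto (fun k => Phi A k t i j) atTop (nhds g)

/-- The trajectory `z(k+1) = A(k) z(k)` started from `z0`. -/
noncomputable def traj {m : ℕ} (A : ℕ → Matrix (Fin m) (Fin m) ℝ) (z0 : Fin m → ℝ) :
    ℕ → Fin m → ℝ
  | 0 => z0
  | k + 1 => (A k).mulVec (traj A z0 k)

/-- A deterministic chain reaches a consensus if for every initial state the trajectory
converges to a multiple of the all-ones vector. -/
def ReachesConsensus {m : ℕ} (A : ℕ → Matrix (Fin m) (Fin m) ℝ) : Prop :=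
  ∀ z0 : Fin m → ℝ, ∃ c : ℝ,
    Tendsto (fun k => traj A z0 k) atTop (nhds (fun _ => c))

/-- `SumInf f` says that `Σ_{k=0}^∞ f(k) = ∞` (partial sums tend to infinity). -/
def SumInf (f : ℕ → ℝ) : Prop :=
  Tendsto (fun n => ∑ k ∈ Finset.range n, f k) atTop atTop

/-- A chain has the infinite flow property if `Σ_k A_S(k) = ∞` for every nonempty
proper subset `S` of the index set. -/
def InfiniteFlow {m : ℕ} (A : ℕ → Matrix (Fin m) (Fin m) ℝ) : Prop :=
  ∀ S : Finset (Fin m), S.Nonempty → S ≠ Finset.univ →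
    SumInf (fun k => flowAcross (A k) S)

/-- Borel measurable structure on matrices (entrywise, i.e. as `Fin m → Fin n → ℝ`). -/
instance matrixMeasurableSpace {m n : ℕ} : MeasurableSpace (Matrix (Fin m) (Fin n) ℝ) :=
  (inferInstance : MeasurableSpace (Fin m → Fin n → ℝ))

/-- The random trajectory `x(k+1) = W(k) x(k)` started from the deterministic `x0`. -/
noncomputable def rtraj {m : ℕ} {Ω : Type*} (W : ℕ → Ω → Matrix (Fin m) (Fin m) ℝ)
    (x0 : Fin m → ℝ) : ℕ → Ω → Fin m → ℝ
  | 0 => fun _ => x0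
  | k + 1 => fun ω => (W k ω).mulVec (rtraj W x0 k ω)

/-- `V(x) = Σ_i π_i (x_i - π^T x)^2`. -/
noncomputable def Vlyap {m : ℕ} (π x : Fin m → ℝ) : ℝ :=
  ∑ i, π i * (x i - ∑ j, π j * x j) ^ 2

/-- Keeping only the terms added before the partial sums reach `θ` still reaches `θ`. -/
theorem min_le_sum_ite_sum_range_lt (f : ℕ → ℝ) (θ : ℝ) (T : ℕ) :
    min θ (∑ k ∈ Finset.range T, f k) ≤
      ∑ k ∈ Finset.range T, if ∑ s ∈ Finset.range k, f s < θ then f k else 0 := by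
  induction T with
  | zero => simp
  | succ T ih =>
    rw [Finset.sum_range_succ, Finset.sum_range_succ]
    split_ifs with h
    · rw [min_eq_right h.le] at ih
      exact (min_le_right _ _).trans (by linarith)
    · rw [min_eq_left (not_lt.mp h)] at ih
      exact (min_le_left _ _).trans (by linarith)

/-- If each index `l` in `P` is a cut at which `y` jumps up by at least `c l`, then the squared
increment of `y` dominates the sum of the squared jumps in between. -/
theorem sum_ite_sq_le_sq_sub (y c : ℕ → ℝ) (P : ℕ → Prop) [DecidablePred P] (m : ℕ)
    (hc : ∀ l, l + 1 < m → 0 ≤ c l)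
    (h : ∀ l, P l → ∀ a b, a ≤ l → l < b → b < m → c l ≤ y b - y a)
    (p q : ℕ) (hpq : p ≤ q) (hq : q < m) :
    ∑ l ∈ Finset.Ico p q, (if P l then c l ^ 2 else 0) ≤ (y q - y p) ^ 2 := by
  have key : ∀ r, p ≤ r → ∀ b, r ≤ b → b < m →
      (∀ l ∈ Finset.Ico p r, ¬ P l) ∨
      ((0 ≤ y b - y p) ∧ ∑ l ∈ Finset.Ico p r, (if P l then c l else 0) ≤ y b - y p) := by
    intro r hr
    induction r, hr using Nat.le_induction with
    | base => intro b _ _; left; simp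
    | succ r hr ih =>
      intro b hb hbm
      rw [Finset.sum_Ico_succ_top hr]
      by_cases hP : P r
      · right
        have hcr := hc r (by omega)
        rw [if_pos hP]
        rcases ih r le_rfl (by omega) with h0 | ⟨h1, h2⟩
        · have hz : ∑ l ∈ Finset.Ico p r, (if P l then c l else 0) = 0 :=
            Finset.sum_eq_zero fun l hl => if_neg (h0 l hl)
          have := h r hP p b hr (by omega) hbm
          rw [hz]
          constructor <;> linarith
        · have := h r hP r b le_rfl (by omega) hbm
          constructor <;> linarith
      · rw [if_neg hP, add_zero]
        rcases ih b (by omega) hbm with h0 | h1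
        · left
          intro l hl
          rw [Finset.mem_Ico] at hl
          rcases Nat.lt_succ_iff_lt_or_eq.mp hl.2 with hl' | rfl
          · exact h0 l (Finset.mem_Ico.mpr ⟨hl.1, hl'⟩)
          · exact hP
        · exact Or.inr h1
  rcases key q hpq q le_rfl hq with h0 | ⟨h1, h2⟩
  · rw [Finset.sum_eq_zero fun l hl => if_neg (h0 l hl)]
    positivity
  · have hnn : ∀ l ∈ Finset.Ico p q, 0 ≤ (if P l then c l else 0) := by
      intro l hl
      rw [Finset.mem_Ico] at hl
      split_ifs
      · exact hc l (by omega)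
      · exact le_rfl
    calc ∑ l ∈ Finset.Ico p q, (if P l then c l ^ 2 else 0)
        = ∑ l ∈ Finset.Ico p q, (if P l then c l else 0) ^ 2 := by
          refine Finset.sum_congr rfl fun l _ => ?_
          split_ifs <;> simp
      _ ≤ (∑ l ∈ Finset.Ico p q, (if P l then c l else 0)) ^ 2 :=
          Finset.sum_sq_le_sq_sum_of_nonneg hnn
      _ ≤ (y q - y p) ^ 2 := pow_le_pow_left₀ (Finset.sum_nonneg hnn) h2 2

theorem flowAcross_eq_sum_ite {m : ℕ} (A : Matrix (Fin m) (Fin m) ℝ) (S : Finset (Fin m)) :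
    flowAcross A S = ∑ i, ∑ j, if (i ∈ S ↔ j ∉ S) then A i j else 0 := by
  have h1 : ∀ i, (∑ j, if (i ∈ S ↔ j ∉ S) then A i j else 0) =
      if i ∈ S then ∑ j ∈ Sᶜ, A i j else ∑ j ∈ S, A i j := by
    intro i
    split_ifs with hi
    · rw [← Finset.sum_add_sum_compl S]
      have h0 : ∑ j ∈ S, (if (i ∈ S ↔ j ∉ S) then A i j else 0) = 0 :=
        Finset.sum_eq_zero fun j hj => if_neg (by tauto)
      rw [h0, zero_add]
      refine Finset.sum_congr rfl fun j hj => if_pos ?_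
      rw [Finset.mem_compl] at hj
      tauto
    · simp [hi]
  simp_rw [h1]
  rw [← Finset.sum_add_sum_compl S, flowAcross]
  simp_rw [Finset.sum_add_distrib]
  congr 1
  · exact Finset.sum_congr rfl fun i hi => by rw [if_pos hi]
  · rw [Finset.sum_comm]
    exact Finset.sum_congr rfl fun i hi => by rw [if_neg (Finset.mem_compl.mp hi)]

/-- A sum over unordered pairs of a quantity vanishing on the diagonal. -/
theorem sum_sum_lt_eq_sum_sum {m : ℕ} (A : Matrix (Fin m) (Fin m) ℝ) (z : Fin m → ℝ) :
    ∑ i : Fin m, ∑ j ∈ Finset.univ.filter (fun j => i < j), (A i j + A j i) * (z j - z i) ^ 2 =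
      ∑ i, ∑ j, A i j * (z j - z i) ^ 2 := by
  have h1 : ∀ i j : Fin m, A i j * (z j - z i) ^ 2 =
      (if i < j then A i j * (z j - z i) ^ 2 else 0) +
        (if j < i then A i j * (z j - z i) ^ 2 else 0) := by
    intro i j
    rcases lt_trichotomy i j with h | rfl | h
    · simp [h, h.not_gt]
    · simp
    · simp [h, h.not_gt]
  rw [Finset.sum_congr rfl fun i _ => Finset.sum_congr rfl fun j _ => h1 i j]
  simp only [Finset.sum_add_distrib]
  rw [Finset.sum_comm (f := fun i j => if j < i then A i j * (z j - z i) ^ 2 else 0)]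
  simp_rw [← Finset.sum_add_distrib, Finset.sum_filter]
  refine Finset.sum_congr rfl fun i _ => Finset.sum_congr rfl fun j _ => ?_
  split_ifs <;> ring

theorem traj_neg {m : ℕ} (A : ℕ → Matrix (Fin m) (Fin m) ℝ) (z0 : Fin m → ℝ) (k : ℕ) :
    traj A (-z0) k = -traj A z0 k := by
  induction k with
  | zero => rfl
  | succ k ih => simp only [traj, ih, Matrix.mulVec_neg]

theorem traj_le {m : ℕ} {A : ℕ → Matrix (Fin m) (Fin m) ℝ} (hA : ∀ k, IsStochastic (A k))
    {z0 : Fin m → ℝ} {hi : ℝ} (hhi : ∀ i, z0 i ≤ hi) (k : ℕ) (i : Fin m) :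
    traj A z0 k i ≤ hi := by
  induction k generalizing i with
  | zero => exact hhi i
  | succ k ih =>
    calc traj A z0 (k + 1) i = ∑ j, A k i j * traj A z0 k j := rfl
      _ ≤ ∑ j, A k i j * hi :=
          Finset.sum_le_sum fun j _ => mul_le_mul_of_nonneg_left (ih j) ((hA k).1 i j)
      _ = hi := by rw [← Finset.sum_mul, (hA k).2 i, one_mul]

/-- The states indexed by `S` can only grow through the accumulated weight from `Sᶜ` to `S`. -/
theorem traj_le_add_mul_sum {m : ℕ} {A : ℕ → Matrix (Fin m) (Fin m) ℝ}
    (hA : ∀ k, IsStochastic (A k)) {z0 : Fin m → ℝ} {α D : ℝ} (hD : 0 ≤ D)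
    (hhi : ∀ i, z0 i ≤ α + D) (S : Finset (Fin m)) (hS : ∀ i ∈ S, z0 i ≤ α) (k : ℕ) :
    ∀ i ∈ S, traj A z0 k i ≤
      α + D * ∑ s ∈ Finset.range k, ∑ i ∈ S, ∑ j ∈ Sᶜ, A s i j := by
  induction k with
  | zero => simpa [traj] using hS
  | succ k ih =>
    intro i hi
    set U := ∑ s ∈ Finset.range k, ∑ i ∈ S, ∑ j ∈ Sᶜ, A s i j with hU
    have hnn : ∀ s i, 0 ≤ ∑ j ∈ Sᶜ, A s i j := fun s i =>
      Finset.sum_nonneg fun j _ => (hA s).1 i j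
    have hU0 : 0 ≤ U := Finset.sum_nonneg fun s _ => Finset.sum_nonneg fun i _ => hnn s i
    have hle : ∑ j ∈ Sᶜ, A k i j ≤ ∑ i ∈ S, ∑ j ∈ Sᶜ, A k i j :=
      Finset.single_le_sum (f := fun i => ∑ j ∈ Sᶜ, A k i j) (fun i _ => hnn k i) hi
    have hrow : ∑ j ∈ S, A k i j + ∑ j ∈ Sᶜ, A k i j = 1 := by
      rw [Finset.sum_add_sum_compl, (hA k).2 i]
    rw [Finset.sum_range_succ, ← hU]
    calc traj A z0 (k + 1) i = ∑ j, A k i j * traj A z0 k j := rfl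
      _ = ∑ j ∈ S, A k i j * traj A z0 k j + ∑ j ∈ Sᶜ, A k i j * traj A z0 k j :=
          (Finset.sum_add_sum_compl S _).symm
      _ ≤ ∑ j ∈ S, A k i j * (α + D * U) + ∑ j ∈ Sᶜ, A k i j * (α + D * U + D) := by
          refine add_le_add (Finset.sum_le_sum fun j hj =>
              mul_le_mul_of_nonneg_left (ih j hj) ((hA k).1 i j))
            (Finset.sum_le_sum fun j _ => mul_le_mul_of_nonneg_left ?_ ((hA k).1 i j))
          have := traj_le hA hhi k j
          have := mul_nonneg hD hU0
          linarith
      _ = α + D * U + D * ∑ j ∈ Sᶜ, A k i j := by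
          rw [← Finset.sum_mul, ← Finset.sum_mul]
          linear_combination (α + D * U) * hrow
      _ ≤ _ := by
          have := mul_le_mul_of_nonneg_left hle hD
          linarith

/-- The gap between `Sᶜ` and `S` shrinks at most proportionally to the accumulated flow. -/
theorem sub_mul_sum_flowAcross_le_traj_sub {m : ℕ} {A : ℕ → Matrix (Fin m) (Fin m) ℝ}
    (hA : ∀ k, IsStochastic (A k)) {z0 : Fin m → ℝ} {lo hi α β : ℝ}
    (hlo : ∀ i, lo ≤ z0 i) (hhi : ∀ i, z0 i ≤ hi) (hα : lo ≤ α) (hβ : β ≤ hi) (hlh : lo ≤ hi)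
    (S : Finset (Fin m)) (hS : ∀ i ∈ S, z0 i ≤ α) (hSc : ∀ i ∉ S, β ≤ z0 i) (k : ℕ)
    {a b : Fin m} (ha : a ∈ S) (hb : b ∉ S) :
    β - α - (hi - lo) * ∑ s ∈ Finset.range k, flowAcross (A s) S ≤
      traj A z0 k b - traj A z0 k a := by
  have hD : 0 ≤ hi - lo := by linarith
  have h1 := traj_le_add_mul_sum hA hD (α := α) (fun i => by linarith [hhi i]) S hS k a ha
  have h2 := traj_le_add_mul_sum hA hD (z0 := -z0) (α := -β)
    (fun i => by simp only [Pi.neg_apply]; linarith [hlo i]) Sᶜ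
    (fun i hi => by simpa using hSc i (Finset.mem_compl.mp hi)) k b (Finset.mem_compl.mpr hb)
  rw [traj_neg, Pi.neg_apply, compl_compl] at h2
  have hf : ∑ s ∈ Finset.range k, flowAcross (A s) S =
      ∑ s ∈ Finset.range k, ∑ i ∈ S, ∑ j ∈ Sᶜ, A s i j +
        ∑ s ∈ Finset.range k, ∑ i ∈ Sᶜ, ∑ j ∈ S, A s i j := by
    rw [← Finset.sum_add_distrib]
    refine Finset.sum_congr rfl fun s _ => ?_
    simp_rw [flowAcross, Finset.sum_add_distrib]
    rw [Finset.sum_comm (s := S) (t := Sᶜ) (f := fun i j => A s j i)]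
  rw [hf, mul_add]
  linarith

/-- Lemma 11: if the accumulated flow up to time `T` across every nonempty proper cut is
at least `δ ∈ (0,1)`, then the weighted sum of squared differences along the trajectory
up to time `T` is bounded below by
`(δ(1-δ)²/(z_{σ_m}(0) - z_{σ_1}(0))) Σ_{i=1}^{m-1} (z_{σ_{i+1}}(0) - z_{σ_i}(0))³`,
where `σ` sorts the entries of `z(0)` in nondecreasing order. -/
theorem stmt16 {m : ℕ} (hm : 2 ≤ m) (A : ℕ → Matrix (Fin m) (Fin m) ℝ)
    (hA : ∀ k, IsStochastic (A k)) (z0 : Fin m → ℝ) (σ : Equiv.Perm (Fin m))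
    (hσ : Monotone fun i => z0 (σ i))
    (hlt : z0 (σ ⟨0, by omega⟩) < z0 (σ ⟨m - 1, by omega⟩))
    (δ : ℝ) (hδ : δ ∈ Set.Ioo (0 : ℝ) 1) (T : ℕ) (hT : 1 ≤ T)
    (hflow : ∀ S : Finset (Fin m), S.Nonempty → S ≠ Finset.univ →
      δ ≤ ∑ k ∈ Finset.range T, flowAcross (A k) S) :
    δ * (1 - δ) ^ 2 / (z0 (σ ⟨m - 1, by omega⟩) - z0 (σ ⟨0, by omega⟩)) *
        ∑ i : Fin (m - 1),
          (z0 (σ (Fin.cast (by omega) i.succ)) - z0 (σ (Fin.cast (by omega) i.castSucc))) ^ 3 ≤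
      ∑ k ∈ Finset.range T, ∑ i : Fin m, ∑ j ∈ Finset.univ.filter (fun j => i < j),
        (A k i j + A k j i) * (traj A z0 k j - traj A z0 k i) ^ 2 := by
  classical
  obtain ⟨hδ0, hδ1⟩ := hδ
  set e : ℕ → Fin m := fun n => σ ⟨min n (m - 1), by omega⟩ with he
  set rk : Fin m → ℕ := fun i => (σ.symm i : ℕ) with hrk
  have hrk_lt : ∀ i, rk i < m := fun i => (σ.symm i).2
  have he_rk : ∀ i, e (rk i) = i := by
    intro i
    have : (⟨min (rk i) (m - 1), by omega⟩ : Fin m) = σ.symm i :=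
      Fin.ext (by have := hrk_lt i; simp only [hrk] at this ⊢; omega)
    simp only [he, this, Equiv.apply_symm_apply]
  have hrk_e : ∀ n, n < m → rk (e n) = n := by
    intro n hn
    simp only [hrk, he, Equiv.symm_apply_apply]
    omega
  have hmono : Monotone fun n => z0 (e n) := by
    intro a b hab
    refine hσ (?_ : (⟨min a (m - 1), _⟩ : Fin m) ≤ ⟨min b (m - 1), _⟩)
    exact min_le_min_right _ hab
  set lo := z0 (σ ⟨0, by omega⟩) with hlo
  set hi := z0 (σ ⟨m - 1, by omega⟩) with hhi
  have hlo_e : z0 (e 0) = lo := by simp [he, hlo]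
  have hhi_e : z0 (e (m - 1)) = hi := by simp [he, hhi]
  have hlo_le : ∀ i, lo ≤ z0 i := by
    intro i
    rw [← he_rk i, ← hlo_e]
    exact hmono (Nat.zero_le _)
  have hle_hi : ∀ i, z0 i ≤ hi := by
    intro i
    rw [← he_rk i, ← hhi_e]
    exact hmono (by have := hrk_lt i; omega)
  have hD : 0 < hi - lo := sub_pos.mpr hlt
  set gap : ℕ → ℝ := fun l => z0 (e (l + 1)) - z0 (e l) with hgap
  have hgap0 : ∀ l, 0 ≤ gap l := fun l => sub_nonneg.mpr (hmono (Nat.le_succ l))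
  have hgapD : ∀ l, gap l ≤ hi - lo := fun l => sub_le_sub (hle_hi _) (hlo_le _)
  set S : ℕ → Finset (Fin m) := fun l => Finset.univ.filter fun i => rk i ≤ l with hS
  have hmemS : ∀ l i, i ∈ S l ↔ rk i ≤ l := fun l i => by simp [hS]
  set θ : ℕ → ℝ := fun l => δ * gap l / (hi - lo) with hθ
  set act : ℕ → ℕ → Prop := fun k l =>
    ∑ s ∈ Finset.range k, flowAcross (A s) (S l) < θ l with hact
  have hjump : ∀ k l, act k l → ∀ a b, a ≤ l → l < b → b < m →
      (1 - δ) * gap l ≤ traj A z0 k (e b) - traj A z0 k (e a) := by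
    intro k l hl a b hal hlb hbm
    have h1 := sub_mul_sum_flowAcross_le_traj_sub hA hlo_le hle_hi (hlo_le (e l))
      (hle_hi (e (l + 1))) hlt.le (S l)
      (fun i hi => by
        rw [hmemS] at hi
        rw [← he_rk i]
        exact hmono hi)
      (fun i hi => by
        rw [hmemS, not_le] at hi
        rw [← he_rk i]
        exact hmono hi)
      k (a := e a) (b := e b) (by rwa [hmemS, hrk_e a (by omega)])
      (by rwa [hmemS, hrk_e b hbm, not_le])
    have h2 := (lt_div_iff₀ hD).mp hl
    simp only [hgap] at h2 ⊢
    linarith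
  have hpair : ∀ k i j, ∑ l ∈ Finset.range (m - 1),
      (if act k l then (if (i ∈ S l ↔ j ∉ S l) then ((1 - δ) * gap l) ^ 2 else 0) else 0) ≤
        (traj A z0 k j - traj A z0 k i) ^ 2 := by
    intro k
    have haux : ∀ i j, rk i ≤ rk j → ∑ l ∈ Finset.range (m - 1),
        (if act k l then (if (i ∈ S l ↔ j ∉ S l) then ((1 - δ) * gap l) ^ 2 else 0) else 0) ≤
          (traj A z0 k j - traj A z0 k i) ^ 2 := by
      intro i j hij
      have h1 := sum_ite_sq_le_sq_sub (fun n => traj A z0 k (e n)) (fun l => (1 - δ) * gap l)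
        (act k) m (fun l _ => mul_nonneg (by linarith) (hgap0 l)) (hjump k) (rk i) (rk j) hij
        (hrk_lt j)
      simp only [he_rk] at h1
      refine le_trans (le_of_eq ?_) h1
      have hsub : Finset.Ico (rk i) (rk j) ⊆ Finset.range (m - 1) := by
        intro l hl
        have := hrk_lt j
        rw [Finset.mem_Ico] at hl
        rw [Finset.mem_range]
        omega
      rw [← Finset.sum_subset hsub]
      · refine Finset.sum_congr rfl fun l hl => ?_
        rw [Finset.mem_Ico] at hl
        have : (i ∈ S l ↔ j ∉ S l) := by
          rw [hmemS, hmemS]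
          omega
        simp only [this, if_true, iff_self]
      · intro l _ hl
        rw [Finset.mem_Ico] at hl
        have : ¬ (i ∈ S l ↔ j ∉ S l) := by
          rw [hmemS, hmemS]
          omega
        rw [if_neg this, ite_self]
    intro i j
    rcases le_total (rk i) (rk j) with h | h
    · exact haux i j h
    · have h1 := haux j i h
      have h2 : ∀ l, (j ∈ S l ↔ i ∉ S l) ↔ (i ∈ S l ↔ j ∉ S l) := fun l => by tauto
      simp only [h2] at h1
      rwa [sub_sq_comm] at h1
  have hstep : ∀ k, ∑ l ∈ Finset.range (m - 1),
      ((1 - δ) * gap l) ^ 2 * (if act k l then flowAcross (A k) (S l) else 0) ≤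
      ∑ i : Fin m, ∑ j ∈ Finset.univ.filter (fun j => i < j),
        (A k i j + A k j i) * (traj A z0 k j - traj A z0 k i) ^ 2 := by
    intro k
    rw [sum_sum_lt_eq_sum_sum]
    calc _ = ∑ l ∈ Finset.range (m - 1), ∑ i, ∑ j, A k i j *
          (if act k l then (if (i ∈ S l ↔ j ∉ S l) then ((1 - δ) * gap l) ^ 2 else 0) else 0) := by
          refine Finset.sum_congr rfl fun l _ => ?_
          split_ifs with h
          · rw [flowAcross_eq_sum_ite, Finset.mul_sum]
            refine Finset.sum_congr rfl fun i _ => ?_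
            rw [Finset.mul_sum]
            refine Finset.sum_congr rfl fun j _ => ?_
            split_ifs <;> ring
          · simp
      _ = ∑ i, ∑ j, A k i j * ∑ l ∈ Finset.range (m - 1),
          (if act k l then (if (i ∈ S l ↔ j ∉ S l) then ((1 - δ) * gap l) ^ 2 else 0) else 0) := by
          rw [Finset.sum_comm]
          refine Finset.sum_congr rfl fun i _ => ?_
          rw [Finset.sum_comm]
          refine Finset.sum_congr rfl fun j _ => ?_
          rw [Finset.mul_sum]
      _ ≤ _ := Finset.sum_le_sum fun i _ => Finset.sum_le_sum fun j _ =>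
          mul_le_mul_of_nonneg_left (hpair k i j) ((hA k).1 i j)
  have hcut : ∀ l ∈ Finset.range (m - 1),
      θ l ≤ ∑ k ∈ Finset.range T, if act k l then flowAcross (A k) (S l) else 0 := by
    intro l hl
    rw [Finset.mem_range] at hl
    have h1 := hflow (S l) ⟨e 0, by rw [hmemS, hrk_e 0 (by omega)]; omega⟩ (by
      intro h
      have h2 : e (m - 1) ∈ S l := h ▸ Finset.mem_univ _
      rw [hmemS, hrk_e _ (by omega)] at h2
      omega)
    have h2 : θ l ≤ δ := by
      rw [hθ, div_le_iff₀ hD]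
      exact mul_le_mul_of_nonneg_left (hgapD l) hδ0.le
    have h3 := min_le_sum_ite_sum_range_lt (fun k => flowAcross (A k) (S l)) (θ l) T
    rwa [min_eq_left (h2.trans h1)] at h3
  have hsum : ∑ i : Fin (m - 1), (z0 (σ (Fin.cast (by omega) i.succ)) -
      z0 (σ (Fin.cast (by omega) i.castSucc))) ^ 3 = ∑ l ∈ Finset.range (m - 1), gap l ^ 3 := by
    rw [Finset.sum_range]
    refine Finset.sum_congr rfl fun i _ => ?_
    have h1 : e (i + 1) = σ (Fin.cast (by omega) i.succ) :=
      congrArg σ (Fin.ext (by simp only [Fin.val_cast, Fin.val_succ]; omega))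
    have h2 : e i = σ (Fin.cast (by omega) i.castSucc) :=
      congrArg σ (Fin.ext (by simp only [Fin.val_cast, Fin.val_castSucc]; omega))
    simp only [hgap, h1, h2]
  rw [hsum, Finset.mul_sum]
  calc _ = ∑ l ∈ Finset.range (m - 1), ((1 - δ) * gap l) ^ 2 * θ l := by
        refine Finset.sum_congr rfl fun l _ => ?_
        simp only [hθ]
        ring
    _ ≤ ∑ l ∈ Finset.range (m - 1), ((1 - δ) * gap l) ^ 2 *
          ∑ k ∈ Finset.range T, (if act k l then flowAcross (A k) (S l) else 0) :=
        Finset.sum_le_sum fun l hl => mul_le_mul_of_nonneg_left (hcut l hl) (sq_nonneg _)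
    _ = ∑ k ∈ Finset.range T, ∑ l ∈ Finset.range (m - 1), ((1 - δ) * gap l) ^ 2 *
          (if act k l then flowAcross (A k) (S l) else 0) := by
        simp_rw [Finset.mul_sum]
        exact Finset.sum_comm
    _ ≤ _ := Finset.sum_le_sum fun k _ => hstep k
end

section
/- Let {A(k)}_{k≥0} ⊂ 𝕊^m be a deterministic chain of stochastic matrices that has a common steady state vector π > 0 (entrywise), i.e., π is a stochastic vector with π^T A(k) = π^T for all k, and the weak feedback property: there exists γ > 0 such that (A^i(k))^T A^j(k) ≥ γ·(A_{ij}(k) + A_{ji}(k)) for all k ≥ 0 and all i ≠ j, where A^i denotes the i-th column of A. Then the chain {A(k)} is ergodic if and only if Σ_{k=0}^∞ A_S(k) = ∞ for every nonempty proper subset S ⊂ {1,…,m}. -/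
open Filter MeasureTheory ProbabilityTheory Matrix

theorem IsStochastic.flowAcross_nonneg {m : ℕ} {B : Matrix (Fin m) (Fin m) ℝ}
    (hB : IsStochastic B) (S : Finset (Fin m)) : 0 ≤ flowAcross B S :=
  Finset.sum_nonneg fun i _ => Finset.sum_nonneg fun j _ => add_nonneg (hB.1 i j) (hB.1 j i)

theorem sumInf_iff_not_summable {f : ℕ → ℝ} (hf : ∀ n, 0 ≤ f n) :
    SumInf f ↔ ¬ Summable f :=
  (not_summable_iff_tendsto_nat_atTop_of_nonneg hf).symm

theorem Phi_self {m : ℕ} (A : ℕ → Matrix (Fin m) (Fin m) ℝ) (t : ℕ) : Phi A t t = A t := by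
  simp [Phi]

theorem Phi_succ {m : ℕ} (A : ℕ → Matrix (Fin m) (Fin m) ℝ) {k t : ℕ} (h : t ≤ k) :
    Phi A (k + 1) t = A (k + 1) * Phi A k t := by
  have h1 : k + 1 + 1 - t = (k + 1 - t) + 1 := by omega
  unfold Phi
  rw [h1, List.range_succ_eq_map, List.map_cons, List.prod_cons, List.map_map]
  congr 3
  funext i
  simp [Nat.succ_eq_add_one]

theorem traj_succ_eq_Phi_mulVec {m : ℕ} (A : ℕ → Matrix (Fin m) (Fin m) ℝ) (t : ℕ)
    (z : Fin m → ℝ) (n : ℕ) :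
    traj (fun k => A (t + k)) z (n + 1) = (Phi A (t + n) t).mulVec z := by
  induction n with
  | zero => simp [traj, Phi_self]
  | succ n ih =>
    rw [traj, ih, Matrix.mulVec_mulVec, ← add_assoc, Phi_succ A (Nat.le_add_right t n)]

theorem isErgodicChain_of_reachesConsensus {m : ℕ} {A : ℕ → Matrix (Fin m) (Fin m) ℝ}
    (h : ∀ t, ReachesConsensus fun k => A (t + k)) : IsErgodicChain A := by
  intro t j
  obtain ⟨c, hc⟩ := h t (Pi.single j 1)
  refine ⟨c, fun i => ?_⟩
  have h1 := (tendsto_add_atTop_iff_nat 1).2 (tendsto_pi_nhds.1 hc i)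
  simp only [traj_succ_eq_Phi_mulVec, Matrix.mulVec_single_one] at h1
  rw [← tendsto_add_atTop_iff_nat t]
  simpa [add_comm t] using h1

/-- An average of the values of `x` along the row `i` stays below `U`, up to the flow out of `S`,
when `x ≤ U` on the complement of `S`. -/
theorem IsStochastic.mulVec_le_add_flowAcross {m : ℕ} {B : Matrix (Fin m) (Fin m) ℝ}
    (hB : IsStochastic B) {S : Finset (Fin m)} {x : Fin m → ℝ} {U : ℝ} (hU : 0 ≤ U)
    (hx : ∀ i, x i ≤ 1) (hxS : ∀ i ∉ S, x i ≤ U) {i : Fin m} (hi : i ∉ S) :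
    B.mulVec x i ≤ U + flowAcross B S := by
  have h1 : B.mulVec x i ≤ ∑ j, (B i j * U + if j ∈ S then B i j else 0) := by
    simp only [Matrix.mulVec, dotProduct]
    refine Finset.sum_le_sum fun j _ => ?_
    have hb := hB.1 i j
    split_ifs with hj
    · have := mul_le_mul_of_nonneg_left (hx j) hb
      have := mul_nonneg hb hU
      linarith
    · have := mul_le_mul_of_nonneg_left (hxS j hj) hb
      linarith
  rw [Finset.sum_add_distrib, ← Finset.sum_mul, hB.2 i, one_mul, Finset.sum_ite_mem,
    Finset.univ_inter] at h1
  refine h1.trans (add_le_add le_rfl (Finset.sum_le_sum fun j _ => ?_))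
  calc B i j ≤ B j i + B i j := le_add_of_nonneg_left (hB.1 j i)
    _ ≤ ∑ l ∈ Sᶜ, (B j l + B l j) :=
      Finset.single_le_sum (f := fun l => B j l + B l j)
        (fun l _ => add_nonneg (hB.1 j l) (hB.1 l j)) (Finset.mem_compl.2 hi)

theorem flowAcross_compl {m : ℕ} (B : Matrix (Fin m) (Fin m) ℝ) (S : Finset (Fin m)) :
    flowAcross B Sᶜ = flowAcross B S := by
  unfold flowAcross
  rw [compl_compl, Finset.sum_comm]
  simp only [add_comm]

theorem IsStochastic.mulVec_le {m : ℕ} {B : Matrix (Fin m) (Fin m) ℝ} (hB : IsStochastic B)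
    {x : Fin m → ℝ} {U : ℝ} (hx : ∀ i, x i ≤ U) (i : Fin m) : B.mulVec x i ≤ U := by
  calc B.mulVec x i = ∑ j, B i j * x j := rfl
    _ ≤ ∑ j, B i j * U :=
        Finset.sum_le_sum fun j _ => mul_le_mul_of_nonneg_left (hx j) (hB.1 i j)
    _ = U := by rw [← Finset.sum_mul, hB.2 i, one_mul]

theorem IsStochastic.le_mulVec {m : ℕ} {B : Matrix (Fin m) (Fin m) ℝ} (hB : IsStochastic B)
    {x : Fin m → ℝ} {U : ℝ} (hx : ∀ i, U ≤ x i) (i : Fin m) : U ≤ B.mulVec x i := by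
  have := hB.mulVec_le (x := -x) (U := -U) (fun i => neg_le_neg (hx i)) i
  rw [Matrix.mulVec_neg] at this
  exact neg_le_neg_iff.1 this

theorem traj_le_sum_flowAcross {m : ℕ} {A : ℕ → Matrix (Fin m) (Fin m) ℝ}
    (hA : ∀ k, IsStochastic (A k)) {S : Finset (Fin m)} {z : Fin m → ℝ}
    (hz : ∀ i, z i ≤ 1) (hzS : ∀ i ∉ S, z i ≤ 0) (n : ℕ) :
    (∀ i, traj A z n i ≤ 1) ∧
      ∀ i ∉ S, traj A z n i ≤ ∑ k ∈ Finset.range n, flowAcross (A k) S := by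
  induction n with
  | zero => simpa [traj] using ⟨hz, hzS⟩
  | succ n ih =>
    refine ⟨(hA n).mulVec_le ih.1, fun i hi => ?_⟩
    rw [Finset.sum_range_succ]
    exact (hA n).mulVec_le_add_flowAcross
      (Finset.sum_nonneg fun k _ => (hA k).flowAcross_nonneg S) ih.1 ih.2 hi

theorem IsErgodicChain.infiniteFlow {m : ℕ} {A : ℕ → Matrix (Fin m) (Fin m) ℝ}
    (hA : ∀ k, IsStochastic (A k)) (h : IsErgodicChain A) : InfiniteFlow A := by
  intro S ⟨a, ha⟩ hSne
  obtain ⟨b, hb⟩ : ∃ b, b ∉ S := by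
    simpa [Finset.eq_univ_iff_forall] using hSne
  rw [sumInf_iff_not_summable fun k => (hA k).flowAcross_nonneg S]
  intro hsum
  obtain ⟨t, ht⟩ := ((tendsto_order.1 (tendsto_sum_nat_add fun k => flowAcross (A k) S)).2
    (1 / 4) (by norm_num)).exists
  have hpart (n : ℕ) : ∑ k ∈ Finset.range n, flowAcross (A (t + k)) S ≤ 1 / 4 := by
    refine le_trans ?_ ht.le
    simp only [add_comm t]
    exact ((summable_nat_add_iff t).2 hsum).sum_le_tsum _
      fun k _ => (hA _).flowAcross_nonneg S
  have key (R : Finset (Fin m)) (hR : ∀ k, flowAcross (A k) R = flowAcross (A k) S) :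
      ∀ i ∉ R, ∀ n, ∑ j ∈ R, Phi A (t + n) t i j ≤ 1 / 4 := by
    intro i hi n
    have h1 := (traj_le_sum_flowAcross (A := fun k => A (t + k)) (fun k => hA (t + k)) (S := R)
      (z := fun j => if j ∈ R then 1 else 0)
      (fun j => by split_ifs <;> norm_num) (fun j hj => by simp [hj]) (n + 1)).2 i hi
    simp only [hR] at h1
    rw [traj_succ_eq_Phi_mulVec] at h1
    simpa [Matrix.mulVec, dotProduct] using h1.trans (hpart _)
  choose g hg using h t
  have hlim (R : Finset (Fin m)) (i : Fin m) :
      Tendsto (fun n => ∑ j ∈ R, Phi A (t + n) t i j) atTop (nhds (∑ j ∈ R, g j)) := by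
    have := (tendsto_add_atTop_iff_nat t).2 (tendsto_finsetSum R fun j _ => hg j i)
    simpa [add_comm t] using this
  have hS := le_of_tendsto' (hlim S b) (key S (fun _ => rfl) b hb)
  have hSc := le_of_tendsto' (hlim Sᶜ a) (key Sᶜ (fun k => flowAcross_compl _ _) a (by simpa))
  have hrow (n : ℕ) : ∑ j, Phi A (t + n) t a j = 1 := by
    have hone (k : ℕ) : traj (fun k => A (t + k)) (fun _ => 1) k = fun _ => 1 := by
      induction k with
      | zero => rfl
      | succ k ih =>
        funext i
        simp [traj, ih, Matrix.mulVec, dotProduct, (hA (t + k)).2 i]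
    have := congrFun (traj_succ_eq_Phi_mulVec A t (fun _ => 1) n) a
    simpa [hone, Matrix.mulVec, dotProduct] using this.symm
  have htot : ∑ j, g j = 1 := by
    refine tendsto_nhds_unique (hlim Finset.univ a) ?_
    simp [hrow]
  have := Finset.sum_add_sum_compl S g
  linarith

/-- The disagreement of `x` along the entries of `B`. -/
noncomputable def disagreement {m : ℕ} (B : Matrix (Fin m) (Fin m) ℝ) (x : Fin m → ℝ) : ℝ :=
  ∑ i, ∑ j, (B i j + B j i) * (x i - x j) ^ 2

theorem IsStochastic.disagreement_nonneg {m : ℕ} {B : Matrix (Fin m) (Fin m) ℝ}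
    (hB : IsStochastic B) (x : Fin m → ℝ) : 0 ≤ disagreement B x :=
  Finset.sum_nonneg fun i _ => Finset.sum_nonneg fun j _ =>
    mul_nonneg (add_nonneg (hB.1 i j) (hB.1 j i)) (sq_nonneg _)

theorem IsStochastic.flowAcross_mul_sq_le_disagreement {m : ℕ} {B : Matrix (Fin m) (Fin m) ℝ}
    (hB : IsStochastic B) {x : Fin m → ℝ} {S : Finset (Fin m)} {d : ℝ} (hd : 0 ≤ d)
    (hx : ∀ i ∈ S, ∀ j ∉ S, d ≤ x i - x j) :
    flowAcross B S * d ^ 2 ≤ disagreement B x := by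
  have hnn (i j : Fin m) : 0 ≤ (B i j + B j i) * (x i - x j) ^ 2 :=
    mul_nonneg (add_nonneg (hB.1 i j) (hB.1 j i)) (sq_nonneg _)
  calc flowAcross B S * d ^ 2
      ≤ ∑ i ∈ S, ∑ j ∈ Sᶜ, (B i j + B j i) * (x i - x j) ^ 2 := by
        rw [flowAcross, Finset.sum_mul]
        refine Finset.sum_le_sum fun i hi => ?_
        rw [Finset.sum_mul]
        refine Finset.sum_le_sum fun j hj => ?_
        exact mul_le_mul_of_nonneg_left
          (pow_le_pow_left₀ hd (hx i hi j (Finset.mem_compl.1 hj)) 2)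
          (add_nonneg (hB.1 i j) (hB.1 j i))
    _ ≤ ∑ i ∈ S, ∑ j, (B i j + B j i) * (x i - x j) ^ 2 :=
        Finset.sum_le_sum fun i _ => Finset.sum_le_univ_sum_of_nonneg fun j => hnn i j
    _ ≤ disagreement B x :=
        Finset.sum_le_univ_sum_of_nonneg fun i => Finset.sum_nonneg fun j _ => hnn i j

/-- The variance of `x` under the weights `w`, written as a sum over pairs. -/
theorem sum_mul_sq_sub_sq_sum {ι : Type*} [Fintype ι] (w x : ι → ℝ) (hw : ∑ i, w i = 1) :
    2 * (∑ i, w i * x i ^ 2 - (∑ i, w i * x i) ^ 2) =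
      ∑ i, ∑ j, w i * w j * (x i - x j) ^ 2 := by
  have h1 (i j : ι) : w i * w j * (x i - x j) ^ 2 =
      (w i * x i ^ 2) * w j + w i * (w j * x j ^ 2) - 2 * ((w i * x i) * (w j * x j)) := by ring
  simp only [h1, Finset.sum_sub_distrib, Finset.sum_add_distrib, ← Finset.mul_sum,
    ← Finset.sum_mul, hw]
  ring

theorem IsStochastic.sq_mulVec_sub_le_disagreement {m : ℕ} {B : Matrix (Fin m) (Fin m) ℝ}
    (hB : IsStochastic B) (x : Fin m → ℝ) (i : Fin m) :
    (B.mulVec x i - x i) ^ 2 ≤ disagreement B x := by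
  have h1 : B.mulVec x i - x i = ∑ j, B i j * (x j - x i) := by
    simp only [mul_sub, Finset.sum_sub_distrib, ← Finset.sum_mul, hB.2 i, one_mul]
    rfl
  calc (B.mulVec x i - x i) ^ 2 ≤ ∑ j, B i j * (x j - x i) ^ 2 := by
        rw [h1]
        have h2 := sum_mul_sq_sub_sq_sum (B i) (fun j => x j - x i) (hB.2 i)
        have h3 : 0 ≤ ∑ j, ∑ l, B i j * B i l * ((x j - x i) - (x l - x i)) ^ 2 :=
          Finset.sum_nonneg fun j _ => Finset.sum_nonneg fun l _ =>
            mul_nonneg (mul_nonneg (hB.1 i j) (hB.1 i l)) (sq_nonneg _)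
        linarith
    _ ≤ ∑ j, (B i j + B j i) * (x i - x j) ^ 2 := by
        refine Finset.sum_le_sum fun j _ => ?_
        have := mul_nonneg (hB.1 j i) (sq_nonneg (x i - x j))
        nlinarith
    _ ≤ disagreement B x :=
        Finset.single_le_sum (f := fun i => ∑ j, (B i j + B j i) * (x i - x j) ^ 2)
          (fun i _ => Finset.sum_nonneg fun j _ =>
            mul_nonneg (add_nonneg (hB.1 i j) (hB.1 j i)) (sq_nonneg _)) (Finset.mem_univ i)

theorem sum_mul_mulVec {m : ℕ} {B : Matrix (Fin m) (Fin m) ℝ} {p : Fin m → ℝ}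
    (hss : ∀ j, ∑ i, p i * B i j = p j) (y : Fin m → ℝ) :
    ∑ i, p i * B.mulVec y i = ∑ i, p i * y i := by
  simp only [Matrix.mulVec, dotProduct, Finset.mul_sum]
  rw [Finset.sum_comm]
  simp only [← mul_assoc, ← Finset.sum_mul, hss]

theorem disagreement_le_decrease {m : ℕ} {B : Matrix (Fin m) (Fin m) ℝ}
    (hB : IsStochastic B) {p : Fin m → ℝ} (hss : ∀ j, ∑ i, p i * B i j = p j)
    {c γ : ℝ} (hc : 0 ≤ c) (hcp : ∀ i, c ≤ p i)
    (hwfb : ∀ i j, i ≠ j → γ * (B i j + B j i) ≤ ∑ l, B l i * B l j) (x : Fin m → ℝ) :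
    c * γ * disagreement B x ≤
      2 * (∑ i, p i * x i ^ 2 - ∑ i, p i * B.mulVec x i ^ 2) := by
  have h1 : 2 * (∑ i, p i * x i ^ 2 - ∑ i, p i * B.mulVec x i ^ 2) =
      ∑ l, p l * ∑ i, ∑ j, B l i * B l j * (x i - x j) ^ 2 := by
    rw [← sum_mul_mulVec hss fun i => x i ^ 2, ← Finset.sum_sub_distrib, Finset.mul_sum]
    refine Finset.sum_congr rfl fun l _ => ?_
    rw [← sum_mul_sq_sub_sq_sum (B l) x (hB.2 l)]
    simp only [Matrix.mulVec, dotProduct]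
    ring
  have h2 : c * ∑ l, ∑ i, ∑ j, B l i * B l j * (x i - x j) ^ 2 ≤
      ∑ l, p l * ∑ i, ∑ j, B l i * B l j * (x i - x j) ^ 2 := by
    rw [Finset.mul_sum]
    exact Finset.sum_le_sum fun l _ => mul_le_mul_of_nonneg_right (hcp l)
      (Finset.sum_nonneg fun i _ => Finset.sum_nonneg fun j _ =>
        mul_nonneg (mul_nonneg (hB.1 l i) (hB.1 l j)) (sq_nonneg _))
  have h3 : γ * disagreement B x ≤ ∑ l, ∑ i, ∑ j, B l i * B l j * (x i - x j) ^ 2 := by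
    rw [Finset.sum_comm, disagreement, Finset.mul_sum]
    refine Finset.sum_le_sum fun i _ => ?_
    rw [Finset.sum_comm, Finset.mul_sum]
    refine Finset.sum_le_sum fun j _ => ?_
    rw [← Finset.sum_mul, ← mul_assoc]
    rcases eq_or_ne i j with rfl | hij
    · simp
    · exact mul_le_mul_of_nonneg_right (hwfb i j hij) (sq_nonneg _)
  rw [h1, mul_assoc]
  exact (mul_le_mul_of_nonneg_left h3 hc).trans h2

theorem sum_mul_posPart_mulVec_le {m : ℕ} {B : Matrix (Fin m) (Fin m) ℝ}
    (hB : IsStochastic B) {p : Fin m → ℝ} (hp : ∀ i, 0 ≤ p i)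
    (hss : ∀ j, ∑ i, p i * B i j = p j) (x : Fin m → ℝ) (a : ℝ) :
    ∑ i, p i * max (B.mulVec x i - a) 0 ≤ ∑ i, p i * max (x i - a) 0 := by
  rw [← sum_mul_mulVec hss fun i => max (x i - a) 0]
  refine Finset.sum_le_sum fun i _ => mul_le_mul_of_nonneg_left ?_ (hp i)
  change _ ≤ ∑ j, B i j * max (x j - a) 0
  refine max_le ?_ ?_
  · have h1 : B.mulVec x i - a = ∑ j, B i j * (x j - a) := by
      simp only [mul_sub, Finset.sum_sub_distrib, ← Finset.sum_mul, hB.2 i, one_mul]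
      rfl
    rw [h1]
    exact Finset.sum_le_sum fun j _ => mul_le_mul_of_nonneg_left (le_max_left _ _) (hB.1 i j)
  · exact Finset.sum_nonneg fun j _ => mul_nonneg (hB.1 i j) (le_max_right _ _)

theorem exists_tendsto_of_antitone_of_le {f : ℕ → ℝ} (hf : Antitone f) {c : ℝ}
    (hc : ∀ n, c ≤ f n) : ∃ l, Tendsto f atTop (nhds l) :=
  ⟨_, tendsto_atTop_ciInf hf ⟨c, Set.forall_mem_range.2 hc⟩⟩

/-- The piecewise linear bump of slope one supported on `[a, b]`. -/
noncomputable def tent (a b y : ℝ) : ℝ :=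
  max (y - a) 0 - 2 * max (y - (a + b) / 2) 0 + max (y - b) 0

theorem tent_eq_zero {a b y : ℝ} (hab : a ≤ b) (hy : y ≤ a ∨ b ≤ y) : tent a b y = 0 := by
  unfold tent
  rcases hy with hy | hy
  · rw [max_eq_right, max_eq_right, max_eq_right] <;> linarith
  · rw [max_eq_left, max_eq_left, max_eq_left] <;> linarith

theorem min_le_tent (a b y : ℝ) : min (y - a) (b - y) ≤ tent a b y := by
  unfold tent
  rcases le_total y ((a + b) / 2) with h | h
  · rw [max_eq_right (a := y - (a + b) / 2) (by linarith)]
    have := le_max_left (y - a) 0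
    have := le_max_right (y - b) 0
    have := min_le_left (y - a) (b - y)
    linarith
  · rw [max_eq_left (a := y - (a + b) / 2) (by linarith)]
    have := le_max_left (y - a) 0
    have := le_max_right (y - b) 0
    have := min_le_right (y - a) (b - y)
    linarith

theorem tent_nonneg {a b : ℝ} (hab : a ≤ b) (y : ℝ) : 0 ≤ tent a b y := by
  by_cases hy : y ≤ a ∨ b ≤ y
  · exact (tent_eq_zero hab hy).ge
  · push Not at hy
    exact (le_min (by linarith) (by linarith)).trans (min_le_tent a b y)

section Trajectory

variable {m : ℕ} {A : ℕ → Matrix (Fin m) (Fin m) ℝ} {p : Fin m → ℝ}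

theorem exists_tendsto_sum_tent (hA : ∀ k, IsStochastic (A k)) (hp : ∀ i, 0 ≤ p i)
    (hss : ∀ k, ∀ j, ∑ i, p i * A k i j = p j) (z : Fin m → ℝ) (a b : ℝ) :
    ∃ l, Tendsto (fun n => ∑ i, p i * tent a b (traj A z n i)) atTop (nhds l) := by
  have h (a : ℝ) :
      ∃ l, Tendsto (fun n => ∑ i, p i * max (traj A z n i - a) 0) atTop (nhds l) :=
    exists_tendsto_of_antitone_of_le
      (antitone_nat_of_succ_le fun n => sum_mul_posPart_mulVec_le (hA n) hp (hss n) _ a)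
      (c := 0) fun n => Finset.sum_nonneg fun i _ => mul_nonneg (hp i) (le_max_right _ _)
  obtain ⟨l₁, h₁⟩ := h a
  obtain ⟨l₂, h₂⟩ := h ((a + b) / 2)
  obtain ⟨l₃, h₃⟩ := h b
  refine ⟨_, ((h₁.sub (h₂.const_mul 2)).add h₃).congr fun n => ?_⟩
  simp only [tent, Finset.mul_sum, ← Finset.sum_sub_distrib, ← Finset.sum_add_distrib]
  exact Finset.sum_congr rfl fun i _ => by ring

theorem summable_disagreement_traj (hA : ∀ k, IsStochastic (A k)) (hp : ∀ i, 0 < p i)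
    (hss : ∀ k, ∀ j, ∑ i, p i * A k i j = p j) {γ : ℝ} (hγ : 0 < γ)
    (hwfb : ∀ k i j, i ≠ j → γ * (A k i j + A k j i) ≤ ∑ l, A k l i * A k l j)
    (z : Fin m → ℝ) : Summable fun n => disagreement (A n) (traj A z n) := by
  obtain ⟨c, hc, hcp⟩ : ∃ c > 0, ∀ i, c ≤ p i := by
    rcases isEmpty_or_nonempty (Fin m) with h | h
    · exact ⟨1, one_pos, fun i => isEmptyElim i⟩
    · obtain ⟨i, hi⟩ := Finite.exists_min p
      exact ⟨p i, hp i, hi⟩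
  have hcγ : 0 < c * γ := mul_pos hc hγ
  have hV (n : ℕ) : 0 ≤ ∑ i, p i * traj A z n i ^ 2 :=
    Finset.sum_nonneg fun i _ => mul_nonneg (hp i).le (sq_nonneg _)
  refine summable_of_sum_range_le (c := 2 / (c * γ) * ∑ i, p i * traj A z 0 i ^ 2)
    (fun n => (hA n).disagreement_nonneg _) fun n => ?_
  have key : c * γ * ∑ k ∈ Finset.range n, disagreement (A k) (traj A z k) ≤
      2 * (∑ i, p i * traj A z 0 i ^ 2 - ∑ i, p i * traj A z n i ^ 2) := by
    induction n with
    | zero => simp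
    | succ n ih =>
      have := disagreement_le_decrease (hA n) (hss n) hc.le hcp (hwfb n) (traj A z n)
      rw [Finset.sum_range_succ, mul_add]
      simp only [traj] at ih this ⊢
      linarith
  rw [div_mul_eq_mul_div, le_div_iff₀ hcγ]
  have := hV n
  linarith

/-- Among `m + 1` consecutive open intervals, one contains none of `m` given points. -/
theorem exists_gap (x : Fin m → ℝ) (L : ℝ) {h : ℝ} (hh : 0 < h) :
    ∃ q : Fin (m + 1), ∀ i, x i ≤ L + q * h ∨ L + (q + 1) * h ≤ x i := by
  by_contra! hcon
  choose f hf using hcon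
  obtain ⟨q, r, hqr, hfe⟩ := Fintype.exists_ne_map_eq_of_card_lt f (by simp)
  have hmono : ∀ q r : Fin (m + 1), f q = f r → ¬ q < r := by
    intro q r hfe hlt
    have h1 := (hf q).2
    have h2 := (hf r).1
    rw [hfe] at h1
    have h3 : ((q : ℕ) : ℝ) + 1 ≤ ((r : ℕ) : ℝ) := by exact_mod_cast hlt
    have := mul_le_mul_of_nonneg_right h3 hh.le
    linarith
  rcases lt_or_gt_of_ne hqr with hlt | hlt
  · exact hmono q r hfe hlt
  · exact hmono r q hfe.symm hlt

theorem exists_eventually_gap (hA : ∀ k, IsStochastic (A k)) (hp : ∀ i, 0 < p i)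
    (hss : ∀ k, ∀ j, ∑ i, p i * A k i j = p j) (z : Fin m → ℝ) {L M : ℝ} (hLM : L < M) :
    ∃ a b, L < a ∧ a < b ∧ b < M ∧
      ∀ᶠ n in atTop, ∀ i, traj A z n i < a ∨ b < traj A z n i := by
  set h : ℝ := (M - L) / (m + 1) with hh_def
  have hm : (0 : ℝ) < m + 1 := by positivity
  have hh : 0 < h := div_pos (sub_pos.2 hLM) hm
  have hM : L + (m + 1) * h = M := by rw [hh_def]; field_simp; ring
  obtain ⟨q, hq⟩ : ∃ q : Fin (m + 1), ∃ᶠ n in atTop,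
      ∀ i, traj A z n i ≤ L + q * h ∨ L + (q + 1) * h ≤ traj A z n i := by
    by_contra! hcon
    obtain ⟨n, hn⟩ := (eventually_all.2 hcon).exists
    obtain ⟨q, hq⟩ := exists_gap (traj A z n) L hh
    obtain ⟨i, hi⟩ := hn q
    exact (hq i).elim hi.1.not_ge hi.2.not_ge
  set a := L + q * h with ha
  have hb : L + (q + 1) * h = a + h := by rw [ha]; ring
  rw [hb] at hq
  have hLa : L ≤ a := le_add_of_nonneg_right (by positivity)
  have hbM : a + h ≤ M := by
    rw [← hb, ← hM]
    have h3 : ((q : ℕ) : ℝ) + 1 ≤ m + 1 := by exact_mod_cast q.is_lt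
    gcongr
  obtain ⟨l, hl⟩ := exists_tendsto_sum_tent hA (fun i => (hp i).le) hss z a (a + h)
  have hl0 : l = 0 := by
    by_contra hne
    refine hq ((hl.eventually_ne hne).mono fun n hn hcon => hn ?_)
    exact Finset.sum_eq_zero fun i _ => by
      rw [tent_eq_zero (by linarith) (hcon i), mul_zero]
  subst hl0
  refine ⟨a + h / 4, a + h - h / 4, by linarith, by linarith, by linarith, ?_⟩
  refine eventually_all.2 fun i => ?_
  filter_upwards [hl.eventually_lt_const (mul_pos (hp i) (by positivity : 0 < h / 4))] with n hn
  by_contra! hcon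
  have h1 : p i * tent a (a + h) (traj A z n i) ≤
      ∑ j, p j * tent a (a + h) (traj A z n j) :=
    Finset.single_le_sum (f := fun j => p j * tent a (a + h) (traj A z n j))
      (fun j _ => mul_nonneg (hp j).le (tent_nonneg (by linarith) _)) (Finset.mem_univ i)
  have h2 := lt_of_mul_lt_mul_left (h1.trans_lt hn) (hp i).le
  have h3 := min_le_tent a (a + h) (traj A z n i)
  have h4 : h / 4 ≤ min (traj A z n i - a) (a + h - traj A z n i) :=
    le_min (by linarith) (by linarith)
  linarith

/-- A gap in the values of the trajectory that persists separates the indices into two classes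
between which the total flow is finite. -/
theorem not_infiniteFlow_of_eventually_gap (hA : ∀ k, IsStochastic (A k)) {z : Fin m → ℝ}
    (hsum : Summable fun n => disagreement (A n) (traj A z n)) {a b : ℝ} (hab : a < b)
    (hgap : ∀ᶠ n in atTop, ∀ i, traj A z n i < a ∨ b < traj A z n i)
    (hhi : ∀ n, ∃ i, b < traj A z n i) (hlo : ∀ n, ∃ i, traj A z n i < a) :
    ¬ InfiniteFlow A := by
  intro hflow
  have hd : 0 < b - a := sub_pos.2 hab
  obtain ⟨N, hN⟩ := eventually_atTop.1 (hgap.and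
    (hsum.tendsto_atTop_zero.eventually_lt_const (pow_pos hd 2)))
  set S := Finset.univ.filter fun i => b < traj A z N i with hS
  have hstep (n : ℕ) (hn : N ≤ n) (i : Fin m) : |traj A z (n + 1) i - traj A z n i| < b - a :=
    abs_lt_of_sq_lt_sq (((hA n).sq_mulVec_sub_le_disagreement _ i).trans_lt (hN n hn).2) hd.le
  have hconst (n : ℕ) (hn : N ≤ n) (i : Fin m) : b < traj A z n i ↔ i ∈ S := by
    induction n, hn using Nat.le_induction with
    | base => simp [hS]
    | succ n hn ih =>
      rw [← ih]
      have h1 := abs_lt.1 (hstep n hn i)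
      have h2 := (hN n hn).1 i
      have h3 := (hN (n + 1) (by omega)).1 i
      constructor
      · intro h
        by_contra h'
        have := h2.resolve_right h'
        linarith
      · intro h
        by_contra h'
        have := h3.resolve_right h'
        linarith
  obtain ⟨i, hi⟩ := hhi N
  obtain ⟨j, hj⟩ := hlo N
  have hSne : S.Nonempty := ⟨i, (hconst N le_rfl i).1 hi⟩
  have hSun : S ≠ Finset.univ := fun h => by
    have := (hconst N le_rfl j).2 (h ▸ Finset.mem_univ j)
    linarith
  refine (sumInf_iff_not_summable fun k => (hA k).flowAcross_nonneg S).1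
    (hflow S hSne hSun) ?_
  rw [← summable_nat_add_iff N]
  refine Summable.of_nonneg_of_le (fun n => (hA _).flowAcross_nonneg S) (fun n => ?_)
    (((summable_nat_add_iff N).2 hsum).div_const ((b - a) ^ 2))
  rw [le_div_iff₀ (pow_pos hd 2)]
  refine (hA _).flowAcross_mul_sq_le_disagreement hd.le fun i hi j hj => ?_
  have hn : N ≤ n + N := Nat.le_add_left N n
  have h1 := (hconst _ hn i).2 hi
  have h2 := ((hN _ hn).1 j).resolve_right fun h => hj ((hconst _ hn j).1 h)
  linarith

theorem InfiniteFlow.reachesConsensus (hA : ∀ k, IsStochastic (A k)) (hp : ∀ i, 0 < p i)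
    (hss : ∀ k, ∀ j, ∑ i, p i * A k i j = p j) {γ : ℝ} (hγ : 0 < γ)
    (hwfb : ∀ k i j, i ≠ j → γ * (A k i j + A k j i) ≤ ∑ l, A k l i * A k l j)
    (hflow : InfiniteFlow A) : ReachesConsensus A := by
  intro z
  rcases isEmpty_or_nonempty (Fin m) with hm | hm
  · exact ⟨0, tendsto_pi_nhds.2 fun i => isEmptyElim i⟩
  have hle (n : ℕ) (i : Fin m) : traj A z n i ≤ ⨆ j, traj A z n j :=
    le_ciSup (Set.finite_range _).bddAbove i
  have hge (n : ℕ) (i : Fin m) : ⨅ j, traj A z n j ≤ traj A z n i :=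
    ciInf_le (Set.finite_range _).bddBelow i
  have hanti : Antitone fun n => ⨆ j, traj A z n j :=
    antitone_nat_of_succ_le fun n => ciSup_le ((hA n).mulVec_le (hle n))
  have hmono : Monotone fun n => ⨅ j, traj A z n j :=
    monotone_nat_of_le_succ fun n => le_ciInf ((hA n).le_mulVec (hge n))
  have i₀ : Fin m := hm.some
  have hbelow : BddBelow (Set.range fun n => ⨆ j, traj A z n j) :=
    ⟨⨅ j, traj A z 0 j, Set.forall_mem_range.2 fun n =>
      (hmono (Nat.zero_le n)).trans ((hge n i₀).trans (hle n i₀))⟩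
  have habove : BddAbove (Set.range fun n => ⨅ j, traj A z n j) :=
    ⟨⨆ j, traj A z 0 j, Set.forall_mem_range.2 fun n =>
      ((hge n i₀).trans (hle n i₀)).trans (hanti (Nat.zero_le n))⟩
  have hsup := tendsto_atTop_ciInf hanti hbelow
  have hinf := tendsto_atTop_ciSup hmono habove
  have hLM := le_of_tendsto_of_tendsto' hinf hsup fun n => (hge n i₀).trans (hle n i₀)
  rcases hLM.eq_or_lt with heq | hlt
  · rw [heq] at hinf
    exact ⟨_, tendsto_pi_nhds.2 fun i => tendsto_of_tendsto_of_tendsto_of_le_of_le hinf hsup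
      (fun n => hge n i) fun n => hle n i⟩
  · obtain ⟨a, b, hLa, hab, hbM, hgap⟩ := exists_eventually_gap hA hp hss z hlt
    refine absurd hflow (not_infiniteFlow_of_eventually_gap hA
      (summable_disagreement_traj hA hp hss hγ hwfb z) hab hgap (fun n => ?_) fun n => ?_)
    · obtain ⟨i, hi⟩ := exists_eq_ciSup_of_finite (f := traj A z n)
      exact ⟨i, by rw [hi]; exact hbM.trans_le (ciInf_le hbelow n)⟩
    · obtain ⟨i, hi⟩ := exists_eq_ciInf_of_finite (f := traj A z n)
      exact ⟨i, by rw [hi]; exact (le_ciSup habove n).trans_lt hLa⟩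

theorem InfiniteFlow.shift (hA : ∀ k, IsStochastic (A k)) (h : InfiniteFlow A) (t : ℕ) :
    InfiniteFlow fun k => A (t + k) := by
  intro S hS hS'
  have h1 := (sumInf_iff_not_summable fun k => (hA k).flowAcross_nonneg S).1 (h S hS hS')
  refine (sumInf_iff_not_summable fun k => (hA (t + k)).flowAcross_nonneg S).2 fun h2 => h1 ?_
  rw [← summable_nat_add_iff t]
  simpa only [add_comm t] using h2

end Trajectory

/-- Corollary 2: a deterministic chain of stochastic matrices with a common steady state
vector `π > 0` and the weak feedback property is ergodic if and only if
`Σ_k A_S(k) = ∞` for every nonempty proper subset `S ⊂ [m]`. -/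
theorem stmt19 {m : ℕ} (A : ℕ → Matrix (Fin m) (Fin m) ℝ)
    (hA : ∀ k, IsStochastic (A k))
    (π : Fin m → ℝ) (hπpos : ∀ i, 0 < π i) (hπ1 : ∑ i, π i = 1)
    (hss : ∀ k, ∀ j : Fin m, ∑ i, π i * A k i j = π j)
    (γ : ℝ) (hγ : 0 < γ)
    (hwfb : ∀ k, ∀ i j : Fin m, i ≠ j →
      γ * (A k i j + A k j i) ≤ ∑ ℓ, A k ℓ i * A k ℓ j) :
    IsErgodicChain A ↔ InfiniteFlow A := by
  exact ⟨IsErgodicChain.infiniteFlow hA, fun h =>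
    isErgodicChain_of_reachesConsensus fun t =>
      (h.shift hA t).reachesConsensus (fun k => hA (t + k)) hπpos (fun k => hss (t + k)) hγ
        fun k => hwfb (t + k)⟩
end
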